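/- arXiv:hep-th/9209109 — 2 statements merged into one kernel-verified Lean document; each statement's English description precedes it below -/
import Mathlib

section
/- For any four Lagrangian subspaces L1, L2, L3, L4 of a real symplectic vector space (E, ω), the signatures of the associated Lagrangian triplets satisfy the cocycle identity s(L2,L3,L4) − s(L1,L3,L4) + s(L1,L2,L4) − s(L1,L2,L3) = 0. -/
open LinearMap (BilinForm)

variable {E : Type*} [AddCommGroup E] [Module ℝ E]

/-- A subspace is Lagrangian iff it equals its symplectic orthogonal. -/
def IsLagrangian (ω : BilinForm ℝ E) (L : Submodule ℝ E) : Prop :=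
  LinearMap.BilinForm.orthogonal ω L = L

/-- Maximal dimension of a subspace on which the function `Q` is positive away from `0`. -/
noncomputable def posIndex {V : Type*} [AddCommGroup V] [Module ℝ V] (Q : V → ℝ) : ℕ :=
  sSup {d : ℕ | ∃ W : Submodule ℝ V, Module.finrank ℝ W = d ∧ ∀ x ∈ W, x ≠ 0 → 0 < Q x}

/-- The quadratic form `Q(L1,L2,L3)` of a triplet of subspaces,
`Q(x1,x2,x3) = ω(x1,x2) + ω(x2,x3) + ω(x3,x1)`. -/
def tripleQ (ω : BilinForm ℝ E) (L1 L2 L3 : Submodule ℝ E) (v : L1 × L2 × L3) : ℝ :=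
  ω v.1 v.2.1 + ω v.2.1 v.2.2 + ω v.2.2 v.1

/-- The signature `s(L1,L2,L3)` of a triplet of subspaces:  the signature (number of positive
squares minus number of negative squares in a diagonalization) of `Q(L1,L2,L3)`, computed as the
maximal dimension of a subspace on which the form is positive definite minus the maximal dimension
of a subspace on which it is negative definite. -/
noncomputable def tripleSig (ω : BilinForm ℝ E) (L1 L2 L3 : Submodule ℝ E) : ℤ :=
  (posIndex (tripleQ ω L1 L2 L3) : ℤ) - (posIndex (fun v => - tripleQ ω L1 L2 L3 v) : ℤ)

open QuadraticMap Module

section Signature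

variable {V U : Type*} [AddCommGroup V] [Module ℝ V] [AddCommGroup U] [Module ℝ U]

theorem posIndex_eq_sigPos [FiniteDimensional ℝ V] (Q : QuadraticForm ℝ V) :
    posIndex Q = sigPos Q := by
  have h : {d : ℕ | ∃ W : Submodule ℝ V, finrank ℝ W = d ∧ ∀ x ∈ W, x ≠ 0 → 0 < Q x} =
      {r | ∃ W : Submodule ℝ V, finrank ℝ W = r ∧ (Q.restrict W).PosDef} := by
    simp [QuadraticMap.PosDef]
  rw [posIndex, h]
  exact (sigPos_isGreatest Q).csSup_eq

/-- The signature of a real quadratic form. -/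
noncomputable def formSig (Q : QuadraticForm ℝ V) : ℤ := (sigPos Q : ℤ) - sigNeg Q

theorem sigPos_comp_le [FiniteDimensional ℝ V] [FiniteDimensional ℝ U]
    (Q : QuadraticForm ℝ V) (f : U →ₗ[ℝ] V) : sigPos (Q.comp f) ≤ sigPos Q := by
  obtain ⟨W, hW, hpos⟩ := exists_finrank_eq_sigPos_and_posDef (Q.comp f)
  have hpos' : ∀ w ∈ W, w ≠ 0 → 0 < Q (f w) := fun w hw h0 =>
    hpos ⟨w, hw⟩ (by simpa using h0)
  have hinj : Function.Injective (f.domRestrict W) := by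
    rw [injective_iff_map_eq_zero]
    rintro ⟨w, hw⟩ h
    by_contra h0
    have := hpos' w hw (by simpa using h0)
    simp_all
  rw [← hW, ← LinearMap.finrank_range_of_inj hinj]
  refine le_sigPos_of_posDef Q ?_
  rintro ⟨_, ⟨w, hw⟩, rfl⟩ h0
  refine hpos' w hw ?_
  rintro rfl
  simp at h0

theorem sigNeg_comp_le [FiniteDimensional ℝ V] [FiniteDimensional ℝ U]
    (Q : QuadraticForm ℝ V) (f : U →ₗ[ℝ] V) : sigNeg (Q.comp f) ≤ sigNeg Q :=
  sigPos_comp_le (-Q) f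

theorem formSig_eq_of_surjective [FiniteDimensional ℝ V] [FiniteDimensional ℝ U]
    {P : QuadraticForm ℝ U} {Q : QuadraticForm ℝ V} (f : U →ₗ[ℝ] V)
    (hf : Function.Surjective f) (h : ∀ u, Q (f u) = P u) : formSig P = formSig Q := by
  obtain ⟨g, hg⟩ := f.exists_rightInverse_of_surjective (LinearMap.range_eq_top.2 hf)
  obtain rfl : Q.comp f = P := QuadraticMap.ext h
  have hQ : (Q.comp f).comp g = Q := by
    ext x
    simpa using congrArg Q (LinearMap.congr_fun hg x)
  have h1 := sigPos_comp_le Q f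
  have h2 := sigNeg_comp_le Q f
  have h3 := sigPos_comp_le (Q.comp f) g
  have h4 := sigNeg_comp_le (Q.comp f) g
  rw [hQ] at h3 h4
  rw [formSig, formSig, le_antisymm h1 h3, le_antisymm h2 h4]

theorem sigPos_add_finrank_le_restrict [FiniteDimensional ℝ V] (Q : QuadraticForm ℝ V)
    (D : Submodule ℝ V) :
    sigPos Q + finrank ℝ D ≤ sigPos (Q.restrict D) + finrank ℝ V := by
  obtain ⟨W, hW, hpos⟩ := exists_finrank_eq_sigPos_and_posDef Q
  have h1 := Submodule.finrank_sup_add_finrank_inf_eq W D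
  have h2 := Submodule.finrank_le (W ⊔ D)
  have h3 : finrank ℝ (W.comap D.subtype) ≤ sigPos (Q.restrict D) := by
    refine le_sigPos_of_posDef _ ?_
    rintro ⟨⟨x, hD⟩, hx⟩ h0
    refine hpos ⟨x, hx⟩ fun h => h0 ?_
    have hx0 : x = 0 := congrArg W.subtype h
    exact Subtype.ext (Subtype.ext hx0)
  have h4 : finrank ℝ (W.comap D.subtype) = finrank ℝ (W ⊓ D : Submodule ℝ V) := by
    rw [← Submodule.finrank_map_subtype_eq, Submodule.map_comap_subtype, inf_comm]
  lia

/-- Restricting a form to the orthogonal of a totally isotropic subspace preserves the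
signature. -/
theorem formSig_restrict_orthogonal [FiniteDimensional ℝ V] (Q : QuadraticForm ℝ V)
    (I : Submodule ℝ V) (hI : ∀ x ∈ I, Q x = 0) :
    formSig (Q.restrict (LinearMap.BilinForm.orthogonal Q.polarBilin I)) = formSig Q := by
  set D := LinearMap.BilinForm.orthogonal Q.polarBilin I with hD
  have hpolar : ∀ x ∈ D, ∀ i ∈ I, polar Q i x = 0 := fun x hx i hi => hx i hi
  have hQ := QuadraticForm.sigPos_add_sigNeg_add_radical (Q := Q)
  have hQD := QuadraticForm.sigPos_add_sigNeg_add_radical (Q := Q.restrict D)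
  have hp := sigPos_add_finrank_le_restrict Q D
  have hn : sigNeg Q + finrank ℝ D ≤ sigNeg (Q.restrict D) + finrank ℝ V :=
    sigPos_add_finrank_le_restrict (-Q) D
  have hdim := LinearMap.BilinForm.finrank_add_finrank_orthogonal' (B := Q.polarBilin) I
  have hker : Q.polarBilin.ker = Q.radical := by
    have : Invertible (2 : ℝ) := invertibleOfNonzero two_ne_zero
    refine le_antisymm (fun x hx => ?_) radical_le_ker_polarBilin
    have hx' : Q.polarBilin x = 0 := hx
    refine ⟨?_, hx'⟩
    have := LinearMap.congr_fun hx' x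
    simpa [polar_self] using this
  rw [hker, ← hD] at hdim
  have hsup := Submodule.finrank_sup_add_finrank_inf_eq I Q.radical
  have hle : I ⊔ Q.radical ≤ D := by
    refine sup_le (fun x hx i hi => ?_) (fun x hx i hi => ?_)
    · change polar Q i x = 0
      rw [polar, hI _ hx, hI _ hi, hI _ (I.add_mem hi hx)]
      simp
    · change polar Q i x = 0
      rw [polar_comm]
      exact LinearMap.congr_fun hx.2 i
  have hrad : (I ⊔ Q.radical).comap D.subtype ≤ (Q.restrict D).radical := by
    rintro ⟨x, hxD⟩ hx
    obtain ⟨i, hi, r, hr, rfl⟩ := Submodule.mem_sup.1 hx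
    obtain ⟨hr0, hr⟩ := mem_radical_iff'.1 hr
    refine mem_radical_iff'.2 ⟨?_, ?_⟩
    · change Q (i + r) = 0
      rw [add_comm, hr, hI i hi]
    · rintro ⟨y, hy⟩
      change Q (i + r + y) = Q y
      rw [add_comm i, add_assoc, hr, QuadraticMap.map_add Q, hI i hi, hpolar y hy i hi]
      simp
  have hfr := Submodule.finrank_mono hrad
  rw [(Submodule.comapSubtypeEquivOfLe hle).finrank_eq] at hfr
  rw [formSig, formSig]
  lia

theorem formSig_prod [FiniteDimensional ℝ V] [FiniteDimensional ℝ U]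
    (P : QuadraticForm ℝ U) (Q : QuadraticForm ℝ V) :
    formSig (QuadraticMap.prod P Q) = formSig P + formSig Q := by
  have hfin : ∀ (A : Submodule ℝ U) (B : Submodule ℝ V),
      finrank ℝ (A.prod B) = finrank ℝ A + finrank ℝ B := fun A B => by
    have h : A.prod B = LinearMap.range (A.subtype.prodMap B.subtype) := by
      simp [LinearMap.range_prodMap]
    rw [h, LinearMap.finrank_range_of_inj, finrank_prod]
    exact Function.Injective.prodMap A.injective_subtype B.injective_subtype
  have hpos : ∀ (P : QuadraticForm ℝ U) (Q : QuadraticForm ℝ V),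
      sigPos P + sigPos Q ≤ sigPos (QuadraticMap.prod P Q) := fun P Q => by
    obtain ⟨A, hA, hPA⟩ := exists_finrank_eq_sigPos_and_posDef P
    obtain ⟨B, hB, hQB⟩ := exists_finrank_eq_sigPos_and_posDef Q
    rw [← hA, ← hB, ← hfin]
    refine le_sigPos_of_posDef _ ?_
    rintro ⟨⟨a, b⟩, ha, hb⟩ h0
    change 0 < P a + Q b
    have h1 : 0 ≤ P a := hPA.nonneg ⟨a, ha⟩
    have h2 : 0 ≤ Q b := hQB.nonneg ⟨b, hb⟩
    by_cases ha0 : a = 0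
    · have : 0 < Q b := hQB ⟨b, hb⟩ (by rintro h; simp_all)
      linarith
    · have : 0 < P a := hPA ⟨a, ha⟩ (by simpa using ha0)
      linarith
  have hneg : sigNeg P + sigNeg Q ≤ sigNeg (QuadraticMap.prod P Q) := by
    have h : -QuadraticMap.prod P Q = QuadraticMap.prod (-P) (-Q) := by
      ext; simp [add_comm]
    rw [← sigPos_neg (Q := QuadraticMap.prod P Q), h]
    exact hpos (-P) (-Q)
  have hrad : P.radical.prod Q.radical ≤ (QuadraticMap.prod P Q).radical := by
    rintro ⟨a, b⟩ ⟨ha, hb⟩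
    obtain ⟨ha0, ha⟩ := mem_radical_iff'.1 ha
    obtain ⟨hb0, hb⟩ := mem_radical_iff'.1 hb
    refine mem_radical_iff'.2 ⟨by simp_all, ?_⟩
    rintro ⟨x, y⟩
    simp [ha, hb]
  have hfr := Submodule.finrank_mono hrad
  rw [hfin] at hfr
  have h1 := QuadraticForm.sigPos_add_sigNeg_add_radical (Q := P)
  have h2 := QuadraticForm.sigPos_add_sigNeg_add_radical (Q := Q)
  have h3 := QuadraticForm.sigPos_add_sigNeg_add_radical (Q := QuadraticMap.prod P Q)
  have h4 := hpos P Q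
  rw [finrank_prod] at h3
  simp only [formSig]
  lia

end Signature

section Restriction

variable {V U : Type*} [AddCommGroup V] [Module ℝ V] [AddCommGroup U] [Module ℝ U]
  [FiniteDimensional ℝ V] [FiniteDimensional ℝ U]

theorem formSig_restrict_eq_of_map {P : QuadraticForm ℝ U} {Q : QuadraticForm ℝ V}
    {A : Submodule ℝ U} {B : Submodule ℝ V} (f : U →ₗ[ℝ] V) (hf : ∀ a ∈ A, f a ∈ B)
    (hsurj : ∀ b ∈ B, ∃ a ∈ A, f a = b) (h : ∀ a ∈ A, Q (f a) = P a) :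
    formSig (P.restrict A) = formSig (Q.restrict B) := by
  refine formSig_eq_of_surjective (f.restrict hf) ?_ fun a => h a a.2
  rintro ⟨b, hb⟩
  obtain ⟨a, ha, rfl⟩ := hsurj b hb
  exact ⟨⟨a, ha⟩, rfl⟩

theorem formSig_restrict_eq_of_isotropic (Q : QuadraticForm ℝ V) {I W W' : Submodule ℝ V}
    (hIW : I ≤ W) (hI : ∀ x ∈ I, Q x = 0)
    (hW' : ∀ w, w ∈ W' ↔ w ∈ W ∧ ∀ i ∈ I, polar Q i w = 0) :
    formSig (Q.restrict W') = formSig (Q.restrict W) := by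
  rw [← formSig_restrict_orthogonal (Q.restrict W) (I.comap W.subtype) fun x hx => hI x hx]
  symm
  refine formSig_restrict_eq_of_map W.subtype ?_ ?_ fun _ _ => rfl
  · rintro ⟨w, hw⟩ h
    exact (hW' w).2 ⟨hw, fun i hi => h ⟨i, hIW hi⟩ hi⟩
  · intro w hw
    obtain ⟨hw, h⟩ := (hW' w).1 hw
    exact ⟨⟨w, hw⟩, fun i hi => h i hi, rfl⟩

theorem formSig_restrict_prod (P : QuadraticForm ℝ U) (Q : QuadraticForm ℝ V)
    (A : Submodule ℝ U) (B : Submodule ℝ V) :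
    formSig ((QuadraticMap.prod P Q).restrict (A.prod B)) =
      formSig (P.restrict A) + formSig (Q.restrict B) := by
  rw [← formSig_prod]
  symm
  refine formSig_eq_of_surjective
    ((A.subtype.prodMap B.subtype).codRestrict (A.prod B) fun x => ⟨x.1.2, x.2.2⟩) ?_
    fun _ => rfl
  rintro ⟨⟨a, b⟩, ha, hb⟩
  exact ⟨(⟨a, ha⟩, ⟨b, hb⟩), rfl⟩

end Restriction

theorem IsLagrangian.apply_eq_zero {ω : BilinForm ℝ E} {L : Submodule ℝ E}
    (hL : IsLagrangian ω L) {x y : E} (hx : x ∈ L) (hy : y ∈ L) : ω x y = 0 := by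
  rw [← hL] at hy
  exact hy x hx

theorem IsLagrangian.mem_of_forall {ω : BilinForm ℝ E} {L : Submodule ℝ E}
    (hL : IsLagrangian ω L) {y : E} (h : ∀ x ∈ L, ω x y = 0) : y ∈ L := by
  rw [← hL]
  exact h

theorem IsLagrangian.mem_sup [FiniteDimensional ℝ E] {ω : BilinForm ℝ E}
    (halt : LinearMap.IsAlt ω) (hnd : LinearMap.BilinForm.Nondegenerate ω)
    {A B : Submodule ℝ E} (hA : IsLagrangian ω A) (hB : IsLagrangian ω B) {y : E}
    (h : ∀ x ∈ A ⊓ B, ω x y = 0) : y ∈ A ⊔ B := by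
  have hAB : LinearMap.BilinForm.orthogonal ω (A ⊔ B) ≤ A ⊓ B := fun x hx =>
    ⟨hA.mem_of_forall fun a ha => hx a (Submodule.mem_sup_left ha),
      hB.mem_of_forall fun b hb => hx b (Submodule.mem_sup_right hb)⟩
  rw [← LinearMap.BilinForm.orthogonal_orthogonal hnd halt.isRefl (A ⊔ B)]
  exact fun x hx => h x (hAB hx)

/-- The pairs in `A × B` that are completed to a triple of sum zero by an element of `C`. -/
def closedTriples (A B C : Submodule ℝ E) : Submodule ℝ (E × E) :=
  A.prod B ⊓ C.comap (LinearMap.fst ℝ E E + LinearMap.snd ℝ E E)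

/-- The triples in `A × B × C` that are completed to a quadruple of sum zero by an element of
`D`. -/
def closedQuadruples (A B C D : Submodule ℝ E) : Submodule ℝ (E × E × E) :=
  A.prod (B.prod C) ⊓
    D.comap (LinearMap.fst ℝ E (E × E) +
      (LinearMap.fst ℝ E E + LinearMap.snd ℝ E E) ∘ₗ LinearMap.snd ℝ E (E × E))

theorem mem_closedTriples {A B C : Submodule ℝ E} {v : E × E} :
    v ∈ closedTriples A B C ↔ (v.1 ∈ A ∧ v.2 ∈ B) ∧ v.1 + v.2 ∈ C := Iff.rfl

theorem mem_closedQuadruples {A B C D : Submodule ℝ E} {v : E × E × E} :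
    v ∈ closedQuadruples A B C D ↔
      (v.1 ∈ A ∧ v.2.1 ∈ B ∧ v.2.2 ∈ C) ∧ v.1 + (v.2.1 + v.2.2) ∈ D := Iff.rfl

/-- The quadratic form `(x, y) ↦ ω(y, x)`. -/
def pairForm (ω : BilinForm ℝ E) : QuadraticForm ℝ (E × E) :=
  LinearMap.BilinMap.toQuadraticMap
    (ω.compl₁₂ (LinearMap.snd ℝ E E) (LinearMap.fst ℝ E E))

/-- The quadratic form `(x, y, z) ↦ ω(y, x) + ω(z, x) + ω(z, y)`. -/
def chainForm (ω : BilinForm ℝ E) : QuadraticForm ℝ (E × E × E) :=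
  LinearMap.BilinMap.toQuadraticMap
      (ω.compl₁₂ ((LinearMap.fst ℝ E E + LinearMap.snd ℝ E E) ∘ₗ LinearMap.snd ℝ E (E × E))
        (LinearMap.fst ℝ E (E × E))) +
    (pairForm ω).comp (LinearMap.snd ℝ E (E × E))

theorem pairForm_apply (ω : BilinForm ℝ E) (v : E × E) : pairForm ω v = ω v.2 v.1 := rfl

theorem chainForm_apply (ω : BilinForm ℝ E) (v : E × E × E) :
    chainForm ω v = ω (v.2.1 + v.2.2) v.1 + ω v.2.2 v.2.1 := rfl

section Lagrangian

variable [FiniteDimensional ℝ E] {ω : BilinForm ℝ E}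

theorem formSig_closedTriples_rotate (halt : LinearMap.IsAlt ω) (A B C : Submodule ℝ E) :
    formSig ((pairForm ω).restrict (closedTriples A B C)) =
      formSig ((pairForm ω).restrict (closedTriples B C A)) := by
  have hneg : ∀ x y, ω x y = -ω y x := fun x y => (halt.neg y x).symm
  refine formSig_restrict_eq_of_map
    ((LinearMap.snd ℝ E E).prod (-(LinearMap.fst ℝ E E + LinearMap.snd ℝ E E))) ?_ ?_ ?_
  · rintro ⟨x, y⟩ ⟨⟨hx, hy⟩, hz⟩
    refine mem_closedTriples.2 ⟨⟨hy, C.neg_mem hz⟩, ?_⟩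
    simpa using hx
  · rintro ⟨y, z⟩ ⟨⟨hy, hz⟩, hx⟩
    refine ⟨(-(y + z), y), mem_closedTriples.2 ⟨⟨A.neg_mem hx, hy⟩, ?_⟩, ?_⟩
    · simpa using hz
    · simp
  · rintro ⟨x, y⟩ -
    simp [pairForm_apply, halt y, hneg x y]

theorem formSig_closedQuadruples_rotate (halt : LinearMap.IsAlt ω) (A B C D : Submodule ℝ E) :
    formSig ((chainForm ω).restrict (closedQuadruples A B C D)) =
      formSig ((chainForm ω).restrict (closedQuadruples B C D A)) := by
  have hneg : ∀ x y, ω x y = -ω y x := fun x y => (halt.neg y x).symm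
  refine formSig_restrict_eq_of_map
    ((LinearMap.fst ℝ E E ∘ₗ LinearMap.snd ℝ E (E × E)).prod
      ((LinearMap.snd ℝ E E ∘ₗ LinearMap.snd ℝ E (E × E)).prod
        (-(LinearMap.fst ℝ E (E × E) +
          (LinearMap.fst ℝ E E + LinearMap.snd ℝ E E) ∘ₗ LinearMap.snd ℝ E (E × E))))) ?_ ?_ ?_
  · rintro ⟨x, y, z⟩ ⟨⟨hx, hy, hz⟩, hw⟩
    refine mem_closedQuadruples.2 ⟨⟨hy, hz, D.neg_mem hw⟩, ?_⟩
    convert A.neg_mem hx using 1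
    change y + (z + -(x + (y + z))) = -x
    abel
  · rintro ⟨y, z, w⟩ ⟨⟨hy, hz, hw⟩, hx⟩
    refine ⟨(-(y + (z + w)), y, z), mem_closedQuadruples.2 ⟨⟨A.neg_mem hx, hy, hz⟩, ?_⟩, ?_⟩
    · convert D.neg_mem hw using 1
      simp
    · simp
  · rintro ⟨x, y, z⟩ -
    simp [chainForm_apply, halt y, halt z, hneg x y, hneg x z, hneg y z]
    ring

theorem formSig_closedQuadruples_split (halt : LinearMap.IsAlt ω)
    (hnd : LinearMap.BilinForm.Nondegenerate ω) {A B C D : Submodule ℝ E}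
    (hA : IsLagrangian ω A) (hC : IsLagrangian ω C) :
    formSig ((chainForm ω).restrict (closedQuadruples A B C D)) =
      formSig ((pairForm ω).restrict (closedTriples A B C)) +
        formSig ((pairForm ω).restrict (closedTriples A C D)) := by
  have hneg : ∀ x y, ω x y = -ω y x := fun x y => (halt.neg y x).symm
  have hIso := formSig_restrict_eq_of_isotropic (chainForm ω)
    (I := (A ⊓ C).map (LinearMap.id.prod ((0 : E →ₗ[ℝ] E).prod (-LinearMap.id))))
    (W := closedQuadruples A B C D)
    (W' := closedQuadruples A B C D ⊓
      (A ⊔ C).comap (LinearMap.fst ℝ E E ∘ₗ LinearMap.snd ℝ E (E × E))) ?_ ?_ ?_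
  · rw [← hIso, ← formSig_restrict_prod]
    symm
    refine formSig_restrict_eq_of_map
      ((LinearMap.fst ℝ E E).coprod (LinearMap.fst ℝ E E) |>.prod
        ((LinearMap.snd ℝ E E ∘ₗ LinearMap.fst ℝ (E × E) (E × E)).prod
          ((-(LinearMap.fst ℝ E E + LinearMap.snd ℝ E E)).coprod (LinearMap.snd ℝ E E)))) ?_ ?_ ?_
    · rintro ⟨⟨x, y⟩, u, v⟩ ⟨⟨⟨hx, hy⟩, hz⟩, ⟨hu, hv⟩, hw⟩
      simp only [LinearMap.add_apply, LinearMap.fst_apply, LinearMap.snd_apply,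
        SetLike.mem_coe, Submodule.mem_comap] at hx hy hz hu hv hw
      refine ⟨mem_closedQuadruples.2 ⟨⟨A.add_mem hx hu, hy, C.add_mem (C.neg_mem hz) hv⟩, ?_⟩, ?_⟩
      · convert hw using 1
        simp
        abel
      · refine Submodule.mem_sup.2 ⟨-x, A.neg_mem hx, x + y, hz, ?_⟩
        simp
    · rintro ⟨x, y, z⟩ ⟨⟨⟨hx, hy, hz⟩, hw⟩, hy'⟩
      obtain ⟨a, ha, c, hc, hac⟩ := Submodule.mem_sup.1 hy'
      simp only [LinearMap.add_apply, LinearMap.fst_apply, LinearMap.snd_apply,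
        LinearMap.comp_apply, SetLike.mem_coe, Submodule.mem_comap] at hx hy hz hw hac
      subst hac
      refine ⟨((-a, a + c), (x + a, z + c)), ⟨mem_closedTriples.2 ⟨⟨A.neg_mem ha, hy⟩, ?_⟩,
        mem_closedTriples.2 ⟨⟨A.add_mem hx ha, C.add_mem hz hc⟩, ?_⟩⟩, ?_⟩
      · simpa using hc
      · convert hw using 1
        simp only
        abel
      · simp
    · rintro ⟨⟨x, y⟩, u, v⟩ ⟨⟨⟨hx, hy⟩, hz⟩, ⟨hu, hv⟩, hw⟩
      simp only [LinearMap.add_apply, LinearMap.fst_apply, LinearMap.snd_apply,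
        SetLike.mem_coe, Submodule.mem_comap] at hx hy hz hu hv hw
      have h1 := hA.apply_eq_zero hx hu
      have h2 := hC.apply_eq_zero hz hv
      have h3 := hneg x v
      have h4 := hneg y v
      have h5 := hneg x y
      simp only [map_add, LinearMap.add_apply] at h2
      simp [chainForm_apply, pairForm_apply, halt x, halt y]
      linarith
  · rintro _ ⟨a, ⟨ha, hc⟩, rfl⟩
    refine mem_closedQuadruples.2 ⟨⟨ha, B.zero_mem, C.neg_mem hc⟩, ?_⟩
    simp
  · rintro _ ⟨a, ⟨ha, hc⟩, rfl⟩
    simp [chainForm_apply, halt a]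
  · rintro ⟨x, y, z⟩
    refine and_congr_right ?_
    rintro ⟨⟨hx, hy, hz⟩, hw⟩
    simp only [LinearMap.add_apply, LinearMap.fst_apply, LinearMap.snd_apply,
      LinearMap.comp_apply, SetLike.mem_coe, Submodule.mem_comap] at hx hy hz hw
    have hpolar : ∀ a ∈ A ⊓ C, polar (chainForm ω) (a, 0, -a) (x, y, z) = 2 * ω y a := by
      rintro a ⟨haA, haC⟩
      have h1 := hA.apply_eq_zero hx haA
      have h2 := hC.apply_eq_zero hz haC
      have h3 := hneg a x
      have h4 := hneg a y
      simp [polar, chainForm_apply, halt a]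
      linarith
    constructor
    · rintro h _ ⟨a, ha, rfl⟩
      obtain ⟨b, hb, c, hc, hbc⟩ := Submodule.mem_sup.1 h
      change b + c = y at hbc
      refine (hpolar a ha).trans ?_
      rw [← hbc, map_add, LinearMap.add_apply, hA.apply_eq_zero hb ha.1,
        hC.apply_eq_zero hc ha.2]
      simp
    · intro h
      refine hA.mem_sup halt hnd hC fun a ha => ?_
      have := (hpolar a ha).symm.trans (h _ ⟨a, ha, rfl⟩)
      rw [hneg]
      change -ω y a = 0
      linarith

theorem tripleSig_eq_formSig (halt : LinearMap.IsAlt ω) {A : Submodule ℝ E}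
    (hA : IsLagrangian ω A) (B C : Submodule ℝ E) :
    tripleSig ω A B C = formSig ((pairForm ω).restrict (closedTriples A B C)) := by
  have hneg : ∀ x y, ω x y = -ω y x := fun x y => (halt.neg y x).symm
  let Q : QuadraticForm ℝ (E × E × E) := LinearMap.BilinMap.toQuadraticMap
      (ω.compl₁₂ (LinearMap.fst ℝ E (E × E))
        ((LinearMap.fst ℝ E E - LinearMap.snd ℝ E E) ∘ₗ LinearMap.snd ℝ E (E × E))) -
    (pairForm ω).comp (LinearMap.snd ℝ E (E × E))
  have hQ : ∀ x y z, Q (x, y, z) = ω x (y - z) - ω z y := fun _ _ _ => rfl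
  let f : A × B × C →ₗ[ℝ] E × E × E := A.subtype.prodMap (B.subtype.prodMap C.subtype)
  have htriple : tripleQ ω A B C = Q.comp f := by
    ext ⟨x, y, z⟩
    change ω (x : E) y + ω (y : E) z + ω (z : E) x = Q ((x : E), (y : E), (z : E))
    rw [hQ, map_sub, hneg z x, hneg z y]
    ring
  have hsig : tripleSig ω A B C = formSig (Q.comp f) := by
    have h : (fun v => -tripleQ ω A B C v) = ⇑(-Q.comp f) := by
      rw [htriple]
      rfl
    rw [tripleSig, h, htriple, posIndex_eq_sigPos, posIndex_eq_sigPos, sigPos_neg, formSig]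
  have hf : formSig (Q.comp f) = formSig (Q.restrict (A.prod (B.prod C))) := by
    refine formSig_eq_of_surjective
      (f.codRestrict (A.prod (B.prod C)) fun x => ⟨x.1.2, x.2.1.2, x.2.2.2⟩) ?_ fun _ => rfl
    rintro ⟨⟨x, y, z⟩, hx, hy, hz⟩
    exact ⟨(⟨x, hx⟩, ⟨y, hy⟩, ⟨z, hz⟩), rfl⟩
  have hIso := formSig_restrict_eq_of_isotropic Q
    (I := A.map (LinearMap.inl ℝ E (E × E)))
    (W := A.prod (B.prod C))
    (W' := A.prod (B.prod C) ⊓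
      A.comap ((LinearMap.fst ℝ E E - LinearMap.snd ℝ E E) ∘ₗ LinearMap.snd ℝ E (E × E))) ?_ ?_ ?_
  · rw [hsig, hf, ← hIso, formSig_closedTriples_rotate halt]
    refine formSig_restrict_eq_of_map
      ((LinearMap.fst ℝ E E).prod (-LinearMap.snd ℝ E E) ∘ₗ LinearMap.snd ℝ E (E × E)) ?_ ?_ ?_
    · rintro ⟨x, y, z⟩ ⟨⟨hx, hy, hz⟩, h⟩
      refine mem_closedTriples.2 ⟨⟨hy, C.neg_mem hz⟩, ?_⟩
      simpa [sub_eq_add_neg] using h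
    · rintro ⟨y, z⟩ ⟨⟨hy, hz⟩, h⟩
      refine ⟨(0, y, -z), ⟨⟨A.zero_mem, hy, C.neg_mem hz⟩, ?_⟩, by simp⟩
      simpa using h
    · rintro ⟨x, y, z⟩ ⟨⟨hx, hy, hz⟩, h⟩
      have := hA.apply_eq_zero hx h
      simp only [LinearMap.comp_apply, LinearMap.sub_apply, LinearMap.fst_apply,
        LinearMap.snd_apply] at this
      rw [hQ, this]
      simp [pairForm_apply]
  · rintro _ ⟨a, ha, rfl⟩
    exact ⟨ha, B.zero_mem, C.zero_mem⟩
  · rintro _ ⟨a, ha, rfl⟩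
    simp [hQ]
  · rintro ⟨x, y, z⟩
    refine and_congr_right ?_
    rintro ⟨hx, hy, hz⟩
    have hpolar : ∀ a ∈ A, polar Q (a, 0, 0) (x, y, z) = ω a (y - z) := by
      intro a ha
      simp [polar, hQ]
    constructor
    · rintro h _ ⟨a, ha, rfl⟩
      exact (hpolar a ha).trans (hA.apply_eq_zero ha h)
    · intro h
      exact hA.mem_of_forall fun a ha => (hpolar a ha).symm.trans (h _ ⟨a, ha, rfl⟩)

end Lagrangian

/-- the cocycle identity for the signature of Lagrangian triplets. -/
theorem signature_cocycle [FiniteDimensional ℝ E]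
    (ω : BilinForm ℝ E) (halt : LinearMap.IsAlt ω)
    (hnd : LinearMap.BilinForm.Nondegenerate ω)
    (L1 L2 L3 L4 : Submodule ℝ E)
    (h1 : IsLagrangian ω L1) (h2 : IsLagrangian ω L2)
    (h3 : IsLagrangian ω L3) (h4 : IsLagrangian ω L4) :
    tripleSig ω L2 L3 L4 - tripleSig ω L1 L3 L4
      + tripleSig ω L1 L2 L4 - tripleSig ω L1 L2 L3 = 0 := by
  have h := formSig_closedQuadruples_rotate halt L1 L2 L3 L4
  rw [formSig_closedQuadruples_split halt hnd h1 h3,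
    formSig_closedQuadruples_split halt hnd h2 h4,
    ← formSig_closedTriples_rotate halt L1 L2 L4] at h
  rw [tripleSig_eq_formSig halt h1, tripleSig_eq_formSig halt h1, tripleSig_eq_formSig halt h1,
    tripleSig_eq_formSig halt h2]
  linarith
end

section
/- Classification of orbits of Sp(E) on Lagrangian triplets: if (L1,L2,L3) and (L1',L2',L3') are two triplets of Lagrangian subspaces of a real symplectic vector space (E, ω) such that dim(L1∩L2∩L3) = dim(L1'∩L2'∩L3'), dim(L1∩L2) = dim(L1'∩L2'), dim(L2∩L3) = dim(L2'∩L3'), dim(L3∩L1) = dim(L3'∩L1'), and s(L1,L2,L3) = s(L1',L2',L3'), then there exists A ∈ Sp(E) with A(L1) = L1', A(L2) = L2' and A(L3) = L3'. -/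
open LinearMap (BilinForm)

variable {E : Type*} [AddCommGroup E] [Module ℝ E]

open Module

lemma posIndex_eq_card {V κ : Type*} [AddCommGroup V] [Module ℝ V] [Fintype κ]
    (Q : V → ℝ) (Ψ : V ≃ₗ[ℝ] (κ → ℝ)) (c : κ → ℝ)
    (hQ : ∀ v, Q v = ∑ k, c k * Ψ v k ^ 2) :
    posIndex Q = Fintype.card {k // 0 < c k} := by
  classical
  have : FiniteDimensional ℝ V := Ψ.symm.finiteDimensional
  refine IsGreatest.csSup_eq ⟨?_, ?_⟩
  · let T : ({k // 0 < c k} → ℝ) →ₗ[ℝ] V :=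
      Ψ.symm.toLinearMap ∘ₗ Function.ExtendByZero.linearMap ℝ Subtype.val
    have hT : ∀ a k, Ψ (T a) k = if h : 0 < c k then a ⟨k, h⟩ else 0 := by
      intro a k
      simp only [T, LinearMap.comp_apply, LinearEquiv.coe_coe, LinearEquiv.apply_symm_apply,
        Function.ExtendByZero.linearMap_apply]
      split_ifs with h
      · exact Subtype.val_injective.extend_apply a 0 ⟨k, h⟩
      · exact Function.extend_apply' _ _ _ (by rintro ⟨⟨j, hj⟩, rfl⟩; exact h hj)
    have hinj : Function.Injective T := by
      intro a b hab
      ext ⟨k, hk⟩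
      have := congrFun (congrArg Ψ hab) k
      simpa [hT, hk] using this
    refine ⟨LinearMap.range T, ?_, ?_⟩
    · rw [LinearMap.finrank_range_of_inj hinj, finrank_fintype_fun_eq_card]
    · rintro _ ⟨a, rfl⟩ hne
      have ha : a ≠ 0 := by rintro rfl; exact hne (map_zero T)
      obtain ⟨⟨k, hk⟩, hak⟩ := Function.ne_iff.1 ha
      rw [hQ]
      refine Finset.sum_pos' (fun j _ => ?_) ⟨k, Finset.mem_univ k, ?_⟩
      · rw [hT]
        split_ifs with h
        · positivity
        · simp
      · rw [hT, dif_pos hk]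
        exact mul_pos hk (by simpa [sq_pos_iff] using hak)
  · rintro _ ⟨W, rfl, hW⟩
    let R : W →ₗ[ℝ] ({k // 0 < c k} → ℝ) :=
      LinearMap.funLeft ℝ ℝ Subtype.val ∘ₗ Ψ.toLinearMap ∘ₗ W.subtype
    have hR : Function.Injective R := by
      rw [← LinearMap.ker_eq_bot, LinearMap.ker_eq_bot']
      rintro ⟨x, hx⟩ hx0
      by_contra hne
      have hpos := hW x hx (fun h => hne (Subtype.ext h))
      rw [hQ] at hpos
      refine absurd hpos (not_lt.2 (Finset.sum_nonpos fun k _ => ?_))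
      by_cases hk : 0 < c k
      · have : Ψ x k = 0 := congrFun hx0 ⟨k, hk⟩
        simp [this]
      · exact mul_nonpos_of_nonpos_of_nonneg (not_lt.1 hk) (sq_nonneg _)
    simpa using LinearMap.finrank_le_finrank_of_injective hR

/-- The configurations, up to a linear symplectic transformation, of three lines
in a symplectic plane. -/
inductive PlaneType
  | coincident | meet12 | meet23 | meet31 | positive | negative
  deriving DecidableEq

namespace PlaneType

instance : Fintype PlaneType where
  elems := {coincident, meet12, meet23, meet31, positive, negative}
  complete t := by cases t <;> simp

lemma sum_eq {M : Type*} [AddCommMonoid M] (g : PlaneType → M) :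
    ∑ t, g t = g coincident + (g meet12 + (g meet23 + (g meet31 + (g positive + g negative)))) := by
  rw [show (Finset.univ : Finset PlaneType) =
    {coincident, meet12, meet23, meet31, positive, negative} from rfl]
  simp

/-- The coefficient along the first basis vector of a generator of each of the three lines. -/
def fst : PlaneType → Fin 3 → ℝ
  | coincident => ![1, 1, 1]
  | meet12 => ![1, 1, 0]
  | meet23 => ![0, 1, 1]
  | meet31 => ![1, 0, 1]
  | positive => ![1, 0, 1]
  | negative => ![0, 1, 1]

/-- The coefficient along the second basis vector of a generator of each of the three lines. -/
def snd : PlaneType → Fin 3 → ℝ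
  | coincident => ![0, 0, 0]
  | meet12 => ![0, 0, 1]
  | meet23 => ![1, 0, 0]
  | meet31 => ![0, 1, 0]
  | positive => ![0, 1, 1]
  | negative => ![1, 0, 1]

lemma fst_snd (t : PlaneType) (j : Fin 3) :
    (t.fst j = 1 ∧ t.snd j = 0) ∨ (t.fst j = 0 ∧ t.snd j = 1) ∨ (t.fst j = 1 ∧ t.snd j = 1) := by
  cases t <;> fin_cases j <;> simp [fst, snd]

lemma eq_mul_of_orthogonal (t : PlaneType) (j : Fin 3) {p q : ℝ}
    (h : t.fst j * p + t.snd j * q = 0) :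
    p = -((t.fst j * q - (1 - t.fst j) * p) * t.snd j) ∧
      q = (t.fst j * q - (1 - t.fst j) * p) * t.fst j := by
  rcases t.fst_snd j with ⟨h1, h2⟩ | ⟨h1, h2⟩ | ⟨h1, h2⟩ <;> rw [h1, h2] at h ⊢ <;>
    constructor <;> linarith

/-- The symplectic form evaluated on the generators of two of the three lines. -/
def pairing (t : PlaneType) (j k : Fin 3) : ℝ := t.fst j * t.snd k - t.snd j * t.fst k

/-- Coordinates on the sum of the three lines diagonalizing the quadratic form of the triplet. -/
noncomputable def diagCoord : PlaneType → Fin 3 → (Fin 3 → ℝ) → ℝ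
  | coincident, k, a => a k
  | meet12, k, a => ![a 0, (a 1 - a 0 + a 2) / 2, (a 2 - a 1 + a 0) / 2] k
  | meet23, k, a => ![a 1, (a 2 - a 1 + a 0) / 2, (a 0 - a 2 + a 1) / 2] k
  | meet31, k, a => ![a 2, (a 0 - a 2 + a 1) / 2, (a 1 - a 0 + a 2) / 2] k
  | positive, k, a => ![(a 0 + a 1) / 2 - a 2, a 2, (a 0 - a 1) / 2] k
  | negative, k, a => ![(a 0 + a 1) / 2 - a 2, a 2, (a 0 - a 1) / 2] k

/-- The diagonal entries of the quadratic form of the triplet in the coordinates `diagCoord`. -/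
def weight : PlaneType → Fin 3 → ℤ
  | coincident => ![0, 0, 0]
  | meet12 => ![0, 1, -1]
  | meet23 => ![0, 1, -1]
  | meet31 => ![0, 1, -1]
  | positive => ![1, -1, -1]
  | negative => ![-1, 1, 1]

lemma sum_weight_mul_diagCoord_sq (t : PlaneType) (a : Fin 3 → ℝ) :
    ∑ k, (t.weight k : ℝ) * t.diagCoord k a ^ 2 =
      t.pairing 0 1 * (a 0 * a 1) + t.pairing 1 2 * (a 1 * a 2) + t.pairing 2 0 * (a 2 * a 0) := by
  cases t <;> simp [Fin.sum_univ_three, weight, diagCoord, pairing, fst, snd] <;> ring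

lemma diagCoord_add (t : PlaneType) (k : Fin 3) (a b : Fin 3 → ℝ) :
    t.diagCoord k (a + b) = t.diagCoord k a + t.diagCoord k b := by
  cases t <;> fin_cases k <;> simp [diagCoord] <;> ring

lemma diagCoord_smul (t : PlaneType) (k : Fin 3) (r : ℝ) (a : Fin 3 → ℝ) :
    t.diagCoord k (r • a) = r * t.diagCoord k a := by
  cases t <;> fin_cases k <;> simp [diagCoord] <;> ring

lemma eq_zero_of_diagCoord_eq_zero (t : PlaneType) (a : Fin 3 → ℝ)
    (h : ∀ k, t.diagCoord k a = 0) : a = 0 := by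
  have h0 := h 0
  have h1 := h 1
  have h2 := h 2
  ext k
  cases t <;> simp [diagCoord] at h0 h1 h2 <;> fin_cases k <;> simp <;> linarith

end PlaneType

/-- A symplectic basis `(e, f)` such that every `L j` is spanned by one line in each of the
planes spanned by `e i` and `f i`, the lines being in the position prescribed by `type i`. -/
structure AdaptedFrame (ω : BilinForm ℝ E) (L : Fin 3 → Submodule ℝ E) (n : ℕ) where
  e : Fin n → E
  f : Fin n → E
  type : Fin n → PlaneType
  ee : ∀ i j, ω (e i) (e j) = 0
  ff : ∀ i j, ω (f i) (f j) = 0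
  ef : ∀ i j, ω (e i) (f j) = if i = j then 1 else 0
  fe : ∀ i j, ω (f i) (e j) = if i = j then -1 else 0
  expand : ∀ x, x = ∑ i, (ω x (f i) • e i - ω x (e i) • f i)
  mem : ∀ i j, (type i).fst j • e i + (type i).snd j • f i ∈ L j

lemma IsLagrangian.mem_iff {ω : BilinForm ℝ E} {L : Submodule ℝ E} (h : IsLagrangian ω L) {x : E} :
    x ∈ L ↔ ∀ y ∈ L, ω y x = 0 := by
  conv_lhs => rw [← show LinearMap.BilinForm.orthogonal ω L = L from h]
  rfl

lemma IsLagrangian.sup_eq_top [FiniteDimensional ℝ E] {ω : BilinForm ℝ E}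
    (hnd : LinearMap.BilinForm.Nondegenerate ω) {L M : Submodule ℝ E} (hL : IsLagrangian ω L)
    (hM : IsLagrangian ω M) (h : L ⊓ M = ⊥) : L ⊔ M = ⊤ := by
  have hL' := LinearMap.BilinForm.finrank_orthogonal hnd L
  have hM' := LinearMap.BilinForm.finrank_orthogonal hnd M
  rw [show LinearMap.BilinForm.orthogonal ω L = L from hL] at hL'
  rw [show LinearMap.BilinForm.orthogonal ω M = M from hM] at hM'
  exact Submodule.eq_top_of_disjoint _ _ (by omega) (disjoint_iff.2 h)

section ExistsPlane

variable {ω : BilinForm ℝ E} {L : Fin 3 → Submodule ℝ E}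

lemma exists_plane_of_mem_of_mem (halt : LinearMap.IsAlt ω) (hL : ∀ j, IsLagrangian ω (L j))
    {i j k : Fin 3} (t : PlaneType)
    (hi : t.fst i = 1 ∧ t.snd i = 0) (hj : t.fst j = 1 ∧ t.snd j = 0)
    (hk : t.fst k = 0 ∧ t.snd k = 1) (hijk : ∀ m, m = i ∨ m = j ∨ m = k) {e : E} (hei : e ∈ L i)
    (hej : e ∈ L j) (hek : e ∉ L k) :
    ∃ (e f : E) (t : PlaneType), ω e f = 1 ∧ ∀ j, t.fst j • e + t.snd j • f ∈ L j := by
  rw [(hL k).mem_iff] at hek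
  push Not at hek
  obtain ⟨y, hy, hne⟩ := hek
  have hne' : ω e y ≠ 0 := by rw [← halt.neg]; simpa using hne
  refine ⟨e, (ω e y)⁻¹ • y, t, by simp [hne'], fun m => ?_⟩
  rcases hijk m with rfl | rfl | rfl
  · simpa [hi] using hei
  · simpa [hj] using hej
  · simpa [hk] using (L m).smul_mem _ hy

lemma exists_plane_of_inf_eq_bot [FiniteDimensional ℝ E] [Nontrivial E]
    (halt : LinearMap.IsAlt ω) (hnd : LinearMap.BilinForm.Nondegenerate ω)
    (hL : ∀ j, IsLagrangian ω (L j)) (h01 : L 0 ⊓ L 1 = ⊥) (h12 : L 1 ⊓ L 2 = ⊥)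
    (h20 : L 2 ⊓ L 0 = ⊥) :
    ∃ (e f : E) (t : PlaneType), ω e f = 1 ∧ ∀ j, t.fst j • e + t.snd j • f ∈ L j := by
  have h01' := (hL 0).sup_eq_top hnd (hL 1) h01
  have h12' := (hL 1).sup_eq_top hnd (hL 2) h12
  have h20' := (hL 2).sup_eq_top hnd (hL 0) h20
  have lift0 : ∀ a ∈ L 0, ∃ b ∈ L 1, a + b ∈ L 2 := by
    intro a _
    obtain ⟨b, hb, c, hc, rfl⟩ := Submodule.mem_sup.1 (h12' ▸ Submodule.mem_top : a ∈ L 1 ⊔ L 2)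
    exact ⟨-b, neg_mem hb, by simpa using hc⟩
  have lift1 : ∀ b ∈ L 1, ∃ a ∈ L 0, a + b ∈ L 2 := by
    intro b _
    obtain ⟨c, hc, a, ha, rfl⟩ := Submodule.mem_sup.1 (h20' ▸ Submodule.mem_top : b ∈ L 2 ⊔ L 0)
    exact ⟨-a, neg_mem ha, by simpa using hc⟩
  obtain ⟨a, ha, b, hb, hab, hne⟩ : ∃ a ∈ L 0, ∃ b ∈ L 1, a + b ∈ L 2 ∧ ω a b ≠ 0 := by
    by_contra! hzero
    have hort : ∀ a ∈ L 0, ∀ b ∈ L 1, ω a b = 0 := by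
      intro a ha b' hb'
      obtain ⟨b, hb, hab⟩ := lift0 a ha
      obtain ⟨a', ha', hab'⟩ := lift1 b' hb'
      have h1 := hzero a ha b hb hab
      have h2 := hzero a' ha' b' hb' hab'
      have h3 := hzero (a + a') (add_mem ha ha') (b + b') (add_mem hb hb')
        (by convert add_mem hab hab' using 1; abel)
      have h4 := (hL 2).mem_iff.1 hab' _ hab
      have h5 := (hL 0).mem_iff.1 ha' _ ha
      have h6 := (hL 1).mem_iff.1 hb' _ hb
      have h7 := halt.neg b a'
      simp only [map_add, LinearMap.add_apply] at h3 h4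
      linarith
    have hle : L 0 ≤ L 1 := fun a ha => (hL 1).mem_iff.2 fun b hb => by
      rw [← halt.neg, hort a ha b hb, neg_zero]
    have hle' : L 1 ≤ L 0 := fun b hb => (hL 0).mem_iff.2 fun a ha => hort a ha b hb
    rw [le_antisymm hle hle', inf_idem] at h01
    rw [le_antisymm hle hle', h01, sup_idem] at h01'
    exact bot_ne_top h01'
  obtain hneg | hpos := lt_or_gt_of_ne hne
  · have hs : Real.sqrt (-ω a b) ^ 2 = -ω a b := Real.sq_sqrt (by linarith)
    have hs0 : Real.sqrt (-ω a b) ≠ 0 := (Real.sqrt_pos.2 (by linarith)).ne'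
    set r := Real.sqrt (-ω a b)
    refine ⟨r⁻¹ • b, r⁻¹ • a, .negative, ?_, fun j => ?_⟩
    · have := halt.neg a b
      simp only [map_smul, LinearMap.smul_apply, smul_eq_mul, ← this, ← hs]
      field_simp
    · fin_cases j
      · simpa [PlaneType.fst, PlaneType.snd] using (L 0).smul_mem _ ha
      · simpa [PlaneType.fst, PlaneType.snd] using (L 1).smul_mem _ hb
      · simpa [PlaneType.fst, PlaneType.snd, add_comm] using (L 2).smul_mem r⁻¹ hab
  · have hs : Real.sqrt (ω a b) ^ 2 = ω a b := Real.sq_sqrt hpos.le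
    have hs0 : Real.sqrt (ω a b) ≠ 0 := (Real.sqrt_pos.2 hpos).ne'
    set r := Real.sqrt (ω a b)
    refine ⟨r⁻¹ • a, r⁻¹ • b, .positive, ?_, fun j => ?_⟩
    · simp only [map_smul, LinearMap.smul_apply, smul_eq_mul, ← hs]
      field_simp
    · fin_cases j
      · simpa [PlaneType.fst, PlaneType.snd] using (L 0).smul_mem _ ha
      · simpa [PlaneType.fst, PlaneType.snd] using (L 1).smul_mem _ hb
      · simpa [PlaneType.fst, PlaneType.snd] using (L 2).smul_mem r⁻¹ hab

lemma exists_plane [FiniteDimensional ℝ E] [Nontrivial E]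
    (halt : LinearMap.IsAlt ω) (hnd : LinearMap.BilinForm.Nondegenerate ω)
    (hL : ∀ j, IsLagrangian ω (L j)) :
    ∃ (e f : E) (t : PlaneType), ω e f = 1 ∧ ∀ j, t.fst j • e + t.snd j • f ∈ L j := by
  by_cases h : ∃ e, e ≠ 0 ∧ e ∈ L 0 ∧ e ∈ L 1 ∧ e ∈ L 2
  · obtain ⟨e, he, h0, h1, h2⟩ := h
    obtain ⟨f, hf⟩ : ∃ f, ω e f ≠ 0 := by
      by_contra! hz
      exact he (hnd.1 e hz)
    refine ⟨e, (ω e f)⁻¹ • f, .coincident, by simp [hf], fun j => ?_⟩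
    fin_cases j <;> simpa [PlaneType.fst, PlaneType.snd]
  push Not at h
  by_cases h01 : L 0 ⊓ L 1 = ⊥
  · by_cases h12 : L 1 ⊓ L 2 = ⊥
    · by_cases h20 : L 2 ⊓ L 0 = ⊥
      · exact exists_plane_of_inf_eq_bot halt hnd hL h01 h12 h20
      · obtain ⟨e, ⟨h2, h0⟩, he⟩ := Submodule.exists_mem_ne_zero_of_ne_bot h20
        exact exists_plane_of_mem_of_mem halt hL .meet31 (i := 2) (j := 0) (k := 1)
          (by simp [PlaneType.fst, PlaneType.snd]) (by simp [PlaneType.fst, PlaneType.snd])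
          (by simp [PlaneType.fst, PlaneType.snd]) (by decide) h2 h0
          (fun h1 => h e he h0 h1 h2)
    · obtain ⟨e, ⟨h1, h2⟩, he⟩ := Submodule.exists_mem_ne_zero_of_ne_bot h12
      exact exists_plane_of_mem_of_mem halt hL .meet23 (i := 1) (j := 2) (k := 0)
          (by simp [PlaneType.fst, PlaneType.snd]) (by simp [PlaneType.fst, PlaneType.snd])
          (by simp [PlaneType.fst, PlaneType.snd]) (by decide) h1 h2
          (fun h0 => h e he h0 h1 h2)
  · obtain ⟨e, ⟨h0, h1⟩, he⟩ := Submodule.exists_mem_ne_zero_of_ne_bot h01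
    exact exists_plane_of_mem_of_mem halt hL .meet12 (i := 0) (j := 1) (k := 2)
          (by simp [PlaneType.fst, PlaneType.snd]) (by simp [PlaneType.fst, PlaneType.snd])
          (by simp [PlaneType.fst, PlaneType.snd]) (by decide) h0 h1
          (fun h2 => h e he h0 h1 h2)

end ExistsPlane

section ComplementaryPlane

variable {ω : BilinForm ℝ E} {e f : E}

/-- The symplectic orthogonal of the plane spanned by `e` and `f`. -/
def planeOrthogonal (ω : BilinForm ℝ E) (e f : E) : Submodule ℝ E :=
  LinearMap.ker (ω e) ⊓ LinearMap.ker (ω f)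

lemma mem_planeOrthogonal {x : E} : x ∈ planeOrthogonal ω e f ↔ ω e x = 0 ∧ ω f x = 0 := by
  simp [planeOrthogonal]

lemma sub_mem_planeOrthogonal (halt : LinearMap.IsAlt ω) (hef : ω e f = 1) (x : E) :
    x - (ω x f • e - ω x e • f) ∈ planeOrthogonal ω e f := by
  have h1 := halt.neg e f
  have h2 := halt.neg e x
  have h3 := halt.neg f x
  have h4 := halt e
  have h5 := halt f
  rw [mem_planeOrthogonal]
  simp only [map_sub, map_smul, smul_eq_mul, h4, h5, hef, ← h1, ← h2, ← h3]
  constructor <;> ring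

lemma nondegenerate_restrict_planeOrthogonal (halt : LinearMap.IsAlt ω)
    (hnd : LinearMap.BilinForm.Nondegenerate ω) (hef : ω e f = 1) :
    LinearMap.BilinForm.Nondegenerate (ω.restrict (planeOrthogonal ω e f)) := by
  have hrefl : (ω.restrict (planeOrthogonal ω e f)).IsRefl := fun x y h => halt.isRefl _ _ h
  refine hrefl.nondegenerate_iff_separatingLeft.2 ?_
  rintro ⟨x, hx⟩ h
  refine Subtype.ext (hnd.1 x fun y => ?_)
  have h1 : ω x (y - (ω y f • e - ω y e • f)) = 0 :=
    h ⟨_, sub_mem_planeOrthogonal halt hef y⟩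
  rw [mem_planeOrthogonal] at hx
  have h2 := halt.neg x e
  have h3 := halt.neg x f
  rw [hx.1] at h2
  rw [hx.2] at h3
  simp only [map_sub, map_smul, smul_eq_mul] at h1
  rw [neg_eq_zero] at h2 h3
  simpa [h2, h3] using h1

lemma IsLagrangian.comap_planeOrthogonal {L : Submodule ℝ E} (halt : LinearMap.IsAlt ω)
    (hef : ω e f = 1) (hL : IsLagrangian ω L) {t : PlaneType} {j : Fin 3}
    (hv : t.fst j • e + t.snd j • f ∈ L) :
    IsLagrangian (ω.restrict (planeOrthogonal ω e f))
      (L.comap (planeOrthogonal ω e f).subtype) := by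
  ext ⟨x, hx⟩
  rw [LinearMap.BilinForm.mem_orthogonal_iff]
  change (∀ y : planeOrthogonal ω e f, (y : E) ∈ L → ω (y : E) x = 0) ↔ x ∈ L
  constructor
  · refine fun h => hL.mem_iff.2 fun y hy => ?_
    have hyv := hL.mem_iff.1 hv y hy
    simp only [map_add, map_smul, smul_eq_mul] at hyv
    obtain ⟨h1, h2⟩ := t.eq_mul_of_orthogonal j hyv
    set c := t.fst j * ω y f - (1 - t.fst j) * ω y e
    have hmem := sub_mem_planeOrthogonal halt hef y
    have hc : ω y f • e - ω y e • f = c • (t.fst j • e + t.snd j • f) := by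
      rw [h1, h2]; module
    have h0 := h ⟨_, hmem⟩ (by simpa [hc] using sub_mem hy (L.smul_mem c hv))
    rw [mem_planeOrthogonal] at hx
    simpa [hx.1, hx.2] using h0
  · exact fun hxL y hy => hL.mem_iff.1 hxL _ hy

end ComplementaryPlane

theorem AdaptedFrame.exists_nonempty {V : Type*} [AddCommGroup V] [Module ℝ V]
    [FiniteDimensional ℝ V] {ω : BilinForm ℝ V} {L : Fin 3 → Submodule ℝ V}
    (halt : LinearMap.IsAlt ω) (hnd : LinearMap.BilinForm.Nondegenerate ω)
    (hL : ∀ j, IsLagrangian ω (L j)) : ∃ n, Nonempty (AdaptedFrame ω L n) := by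
  rcases subsingleton_or_nontrivial V with hV | hV
  · exact ⟨0, ⟨Fin.elim0, Fin.elim0, Fin.elim0, fun i => i.elim0, fun i => i.elim0,
      fun i => i.elim0, fun i => i.elim0, fun x => Subsingleton.elim _ _, fun i => i.elim0⟩⟩
  obtain ⟨e, f, t, hef, hmem⟩ := exists_plane halt hnd hL
  have hfe : ω f e = -1 := by rw [← halt.neg, hef]
  have hlt : finrank ℝ (planeOrthogonal ω e f) < finrank ℝ V := by
    refine Submodule.finrank_lt fun h => ?_
    have : f ∈ planeOrthogonal ω e f := h ▸ Submodule.mem_top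
    rw [mem_planeOrthogonal, hef] at this
    exact one_ne_zero this.1
  obtain ⟨n, ⟨F⟩⟩ := AdaptedFrame.exists_nonempty (ω := ω.restrict (planeOrthogonal ω e f))
    (L := fun j => (L j).comap (planeOrthogonal ω e f).subtype) (fun x => halt x)
    (nondegenerate_restrict_planeOrthogonal halt hnd hef)
    (fun j => (hL j).comap_planeOrthogonal halt hef (hmem j))
  have hleft : ∀ x : planeOrthogonal ω e f, ω e x = 0 ∧ ω f x = 0 :=
    fun x => mem_planeOrthogonal.1 x.2
  have hright : ∀ x : planeOrthogonal ω e f, ω x e = 0 ∧ ω x f = 0 := fun x => by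
    rw [← halt.neg, ← halt.neg f, (hleft x).1, (hleft x).2]; simp
  refine ⟨n + 1, ⟨⟨Fin.cons e fun i => F.e i, Fin.cons f fun i => F.f i, Fin.cons t F.type,
    ?_, ?_, ?_, ?_, ?_, ?_⟩⟩⟩
  · simpa [Fin.forall_fin_succ, halt e, hleft, hright] using F.ee
  · simpa [Fin.forall_fin_succ, halt f, hleft, hright] using F.ff
  · simpa [Fin.forall_fin_succ, hef, hleft, hright, (Fin.succ_ne_zero _).symm] using F.ef
  · simpa [Fin.forall_fin_succ, hfe, hleft, hright, (Fin.succ_ne_zero _).symm] using F.fe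
  · intro x
    have h := congrArg Subtype.val (F.expand ⟨_, sub_mem_planeOrthogonal halt hef x⟩)
    simp only [LinearMap.BilinForm.restrict_apply, LinearMap.domRestrict_apply, map_sub, map_smul,
      LinearMap.sub_apply, LinearMap.smul_apply, (hleft _).1, (hleft _).2, smul_zero, sub_zero,
      Submodule.coe_sum, Submodule.coe_sub, Submodule.coe_smul] at h
    rw [Fin.sum_univ_succ]
    simp only [Fin.cons_zero, Fin.cons_succ]
    rw [← h]
    abel
  · simpa [Fin.forall_fin_succ, hmem] using F.mem
termination_by finrank ℝ V

namespace AdaptedFrame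

variable {ω : BilinForm ℝ E} {L : Fin 3 → Submodule ℝ E} {n : ℕ} (F : AdaptedFrame ω L n)

/-- The generator of the line `L j` in the `i`-th plane. -/
def line (j : Fin 3) (i : Fin n) : E := (F.type i).fst j • F.e i + (F.type i).snd j • F.f i

/-- The coordinate along `F.line j i` of a vector of `L j`. -/
def coord (j : Fin 3) (i : Fin n) : E →ₗ[ℝ] ℝ :=
  ω.flip ((F.type i).fst j • F.f i - (1 - (F.type i).fst j) • F.e i)

lemma coord_apply (j : Fin 3) (i : Fin n) (x : E) :
    F.coord j i x = (F.type i).fst j * ω x (F.f i) - (1 - (F.type i).fst j) * ω x (F.e i) := by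
  simp [coord]

lemma pairing_line (j k : Fin 3) (i l : Fin n) :
    ω (F.line j i) (F.line k l) = if i = l then (F.type i).pairing j k else 0 := by
  simp only [line, map_add, map_smul, LinearMap.add_apply, LinearMap.smul_apply, smul_eq_mul, F.ee,
    F.ff, F.ef, F.fe, PlaneType.pairing]
  split_ifs with h
  · subst h; ring
  · ring

lemma coord_line (j : Fin 3) (i l : Fin n) : F.coord j l (F.line j i) = if i = l then 1 else 0 := by
  simp only [line, map_add, map_smul, coord_apply, smul_eq_mul, F.ee, F.ff, F.ef, F.fe]
  split_ifs with h
  · subst h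
    rcases (F.type i).fst_snd j with ⟨h1, h2⟩ | ⟨h1, h2⟩ | ⟨h1, h2⟩ <;> simp [h1, h2]
  · ring

lemma eq_sum_coord (hL : ∀ j, IsLagrangian ω (L j)) {j : Fin 3} {x : E} (hx : x ∈ L j) :
    x = ∑ i, F.coord j i x • F.line j i := by
  conv_lhs => rw [F.expand x]
  refine Finset.sum_congr rfl fun i _ => ?_
  have h := (hL j).mem_iff.1 (F.mem i j) x hx
  simp only [map_add, map_smul, smul_eq_mul] at h
  obtain ⟨h1, h2⟩ := (F.type i).eq_mul_of_orthogonal j h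
  rw [← F.coord_apply] at h1 h2
  rw [h1, h2, line]
  module

lemma linearIndependent_line (j : Fin 3) : LinearIndependent ℝ (F.line j) := by
  refine Fintype.linearIndependent_iff.2 fun g hg l => ?_
  simpa [coord_line] using congrArg (F.coord j l) hg

lemma span_line (hL : ∀ j, IsLagrangian ω (L j)) (j : Fin 3) :
    Submodule.span ℝ (Set.range (F.line j)) = L j := by
  refine le_antisymm (Submodule.span_le.2 ?_) fun x hx => ?_
  · rintro _ ⟨i, rfl⟩
    exact F.mem i j
  · rw [F.eq_sum_coord hL hx]
    exact sum_mem fun i _ => Submodule.smul_mem _ _ (Submodule.subset_span ⟨i, rfl⟩)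

/-- The basis formed by the vectors `F.e i` and `F.f i`. -/
noncomputable def basis : Basis (Fin n ⊕ Fin n) ℝ E :=
  Basis.mk (v := Sum.elim F.e F.f)
    (by
      refine Fintype.linearIndependent_iff.2 fun g hg => ?_
      rw [Fintype.sum_sum_type] at hg
      rintro (l | l)
      · simpa [F.ef, F.ff] using congrArg (fun x => ω x (F.f l)) hg
      · simpa [F.ee, F.fe] using congrArg (fun x => ω x (F.e l)) hg)
    (by
      intro x _
      rw [F.expand x]
      exact sum_mem fun i _ => sub_mem
        (Submodule.smul_mem _ _ (Submodule.subset_span ⟨Sum.inl i, rfl⟩))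
        (Submodule.smul_mem _ _ (Submodule.subset_span ⟨Sum.inr i, rfl⟩)))

@[simp] lemma basis_inl (i : Fin n) : F.basis (Sum.inl i) = F.e i := by simp [basis]

@[simp] lemma basis_inr (i : Fin n) : F.basis (Sum.inr i) = F.f i := by simp [basis]

include F in
lemma finrank_eq : finrank ℝ E = n + n := by
  simpa using finrank_eq_card_basis F.basis

lemma finrank_eq_card (hL : ∀ j, IsLagrangian ω (L j)) {j : Fin 3} {M : Submodule ℝ E}
    (S : Fin n → Prop) [DecidablePred S]
    (hM : ∀ x, x ∈ M ↔ x ∈ L j ∧ ∀ i, ¬ S i → F.coord j i x = 0) :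
    finrank ℝ M = ∑ i, if S i then 1 else 0 := by
  have hspan : M = Submodule.span ℝ (Set.range fun i : {i // S i} => F.line j i) := by
    refine le_antisymm (fun x hx => ?_) (Submodule.span_le.2 ?_)
    · obtain ⟨hxL, hx⟩ := (hM x).1 hx
      rw [F.eq_sum_coord hL hxL]
      refine sum_mem fun i _ => ?_
      by_cases hi : S i
      · exact Submodule.smul_mem _ _ (Submodule.subset_span ⟨⟨i, hi⟩, rfl⟩)
      · simp [hx i hi]
    · rintro _ ⟨⟨i, hi⟩, rfl⟩
      refine (hM _).2 ⟨F.mem i j, fun l hl => ?_⟩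
      rw [coord_line, if_neg (by rintro rfl; exact hl hi)]
  have hli : LinearIndependent ℝ fun i : {i // S i} => F.line j i :=
    (F.linearIndependent_line j).comp _ Subtype.val_injective
  rw [hspan, finrank_span_eq_card hli, Fintype.card_subtype]
  simp

lemma mem_iff_coord (hL : ∀ j, IsLagrangian ω (L j)) {j : Fin 3} (k : Fin 3) {x : E}
    (hx : x ∈ L j) : x ∈ L k ↔ ∀ i, (F.type i).pairing k j ≠ 0 → F.coord j i x = 0 := by
  have hpair : ∀ l, ω (F.line k l) x = F.coord j l x * (F.type l).pairing k j := fun l => by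
    conv_lhs => rw [F.eq_sum_coord hL hx]
    simp [pairing_line]
  constructor
  · intro hxk i hi
    have h := (hL k).mem_iff.1 hxk (F.line k i) (F.mem i k)
    simpa [hpair, hi] using h
  · refine fun h => (hL k).mem_iff.2 fun y hy => ?_
    rw [F.eq_sum_coord hL hy, map_sum, LinearMap.sum_apply]
    refine Finset.sum_eq_zero fun l _ => ?_
    by_cases hl : (F.type l).pairing k j = 0
    · simp [hpair, hl]
    · simp [hpair, h l hl]

open Classical in
lemma finrank_inf (hL : ∀ j, IsLagrangian ω (L j)) (j k : Fin 3) :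
    finrank ℝ ↥(L j ⊓ L k) = ∑ i, if (F.type i).pairing k j = 0 then 1 else 0 :=
  F.finrank_eq_card hL (fun i => (F.type i).pairing k j = 0) fun _ =>
    and_congr_right fun hx => F.mem_iff_coord hL k hx

open Classical in
lemma finrank_inf_inf (hL : ∀ j, IsLagrangian ω (L j)) (j k l : Fin 3) :
    finrank ℝ ↥(L j ⊓ L k ⊓ L l) =
      ∑ i, if (F.type i).pairing k j = 0 ∧ (F.type i).pairing l j = 0 then 1 else 0 := by
  refine F.finrank_eq_card hL (j := j)
    (fun i => (F.type i).pairing k j = 0 ∧ (F.type i).pairing l j = 0) fun x => ?_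
  rw [Submodule.mem_inf, Submodule.mem_inf, and_assoc]
  refine and_congr_right fun hx => ?_
  rw [F.mem_iff_coord hL k hx, F.mem_iff_coord hL l hx, ← forall_and]
  refine forall_congr' fun i => ?_
  tauto

include F in
lemma finrank_lagrangian (hL : ∀ j, IsLagrangian ω (L j)) (j : Fin 3) : finrank ℝ (L j) = n := by
  simpa using F.finrank_eq_card hL (j := j) (fun _ => True) (by simp)

/-- Coordinates diagonalizing the quadratic form of the triplet. -/
noncomputable def diagMap : (L 0 × L 1 × L 2) →ₗ[ℝ] (Fin n × Fin 3 → ℝ) where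
  toFun v p := (F.type p.1).diagCoord p.2
    ![F.coord 0 p.1 v.1, F.coord 1 p.1 v.2.1, F.coord 2 p.1 v.2.2]
  map_add' v w := by
    ext p
    simp [← PlaneType.diagCoord_add]
  map_smul' r v := by
    ext p
    simp [← PlaneType.diagCoord_smul]

lemma diagMap_injective (hL : ∀ j, IsLagrangian ω (L j)) : Function.Injective F.diagMap := by
  rw [← LinearMap.ker_eq_bot, LinearMap.ker_eq_bot']
  rintro ⟨x, y, z⟩ h
  have h0 : ∀ i, ![F.coord 0 i x, F.coord 1 i y, F.coord 2 i z] = 0 := fun i =>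
    (F.type i).eq_zero_of_diagCoord_eq_zero _ fun k => congrFun h (i, k)
  have hx : (x : E) = 0 := by
    rw [F.eq_sum_coord hL x.2]
    exact Finset.sum_eq_zero fun i _ => by simpa using Or.inl (congrFun (h0 i) 0)
  have hy : (y : E) = 0 := by
    rw [F.eq_sum_coord hL y.2]
    exact Finset.sum_eq_zero fun i _ => by simpa using Or.inl (congrFun (h0 i) 1)
  have hz : (z : E) = 0 := by
    rw [F.eq_sum_coord hL z.2]
    exact Finset.sum_eq_zero fun i _ => by simpa using Or.inl (congrFun (h0 i) 2)
  simp_all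

lemma apply_eq_sum_coord (hL : ∀ j, IsLagrangian ω (L j)) {j k : Fin 3} {x y : E}
    (hx : x ∈ L j) (hy : y ∈ L k) :
    ω x y = ∑ i, (F.type i).pairing j k * (F.coord j i x * F.coord k i y) := by
  conv_lhs => rw [F.eq_sum_coord hL hx, F.eq_sum_coord hL hy]
  simp only [map_sum, map_smul, LinearMap.sum_apply, LinearMap.smul_apply, pairing_line,
    smul_eq_mul, mul_ite, mul_zero, Finset.sum_ite_eq', Finset.mem_univ, if_true]
  exact Finset.sum_congr rfl fun i _ => by ring

lemma tripleQ_eq_sum (hL : ∀ j, IsLagrangian ω (L j)) (v : L 0 × L 1 × L 2) :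
    tripleQ ω (L 0) (L 1) (L 2) v =
      ∑ p : Fin n × Fin 3, ((F.type p.1).weight p.2 : ℝ) * F.diagMap v p ^ 2 := by
  rw [tripleQ, F.apply_eq_sum_coord hL v.1.2 v.2.1.2, F.apply_eq_sum_coord hL v.2.1.2 v.2.2.2,
    F.apply_eq_sum_coord hL v.2.2.2 v.1.2, ← Finset.sum_add_distrib, ← Finset.sum_add_distrib,
    Fintype.sum_prod_type]
  refine Finset.sum_congr rfl fun i _ => ?_
  exact ((F.type i).sum_weight_mul_diagCoord_sq
    ![F.coord 0 i v.1, F.coord 1 i v.2.1, F.coord 2 i v.2.2]).symm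

lemma tripleSig_eq_sum [FiniteDimensional ℝ E] (hL : ∀ j, IsLagrangian ω (L j)) :
    tripleSig ω (L 0) (L 1) (L 2) = ∑ i, ∑ k, ((if 0 < (F.type i).weight k then (1 : ℤ) else 0) -
      if (F.type i).weight k < 0 then 1 else 0) := by
  have hrank : finrank ℝ (L 0 × L 1 × L 2) = finrank ℝ (Fin n × Fin 3 → ℝ) := by
    simp [F.finrank_lagrangian hL]
    ring
  let Ψ := F.diagMap.linearEquivOfInjective (F.diagMap_injective hL) hrank
  have hΨ : ∀ v, Ψ v = F.diagMap v := fun v => rfl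
  rw [tripleSig, posIndex_eq_card _ Ψ (fun p => ((F.type p.1).weight p.2 : ℝ))
    (fun v => F.tripleQ_eq_sum hL v), posIndex_eq_card _ Ψ (fun p => -((F.type p.1).weight p.2 : ℝ))
    (fun v => by simp [F.tripleQ_eq_sum hL v, hΨ])]
  simp_rw [Fintype.card_subtype, Finset.card_filter, Fintype.sum_prod_type]
  simp only [Int.cast_pos, Left.neg_pos_iff, Int.cast_lt_zero, Nat.cast_sum, Nat.cast_ite,
    Nat.cast_one, Nat.cast_zero, Finset.sum_sub_distrib]

end AdaptedFrame

lemma sum_comp_eq_sum_card_mul {M ι κ : Type*} [CommSemiring M] [Fintype ι] [Fintype κ]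
    [DecidableEq κ] (t : ι → κ) (g : κ → M) :
    ∑ i, g (t i) = ∑ s, (Fintype.card {i // t i = s} : M) * g s := by
  rw [← Finset.sum_fiberwise (s := Finset.univ) (g := t)]
  refine Finset.sum_congr rfl fun s _ => ?_
  rw [Fintype.card_subtype, ← nsmul_eq_mul]
  exact Finset.sum_eq_card_nsmul (by simp +contextual)

theorem AdaptedFrame.exists_equiv {ω : BilinForm ℝ E} {L L' : Fin 3 → Submodule ℝ E} {n n' : ℕ}
    (F : AdaptedFrame ω L n) (F' : AdaptedFrame ω L' n') (hL : ∀ j, IsLagrangian ω (L j))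
    (hL' : ∀ j, IsLagrangian ω (L' j)) (σ : Fin n ≃ Fin n') (hσ : ∀ i, F'.type (σ i) = F.type i) :
    ∃ A : E ≃ₗ[ℝ] E, (∀ x y : E, ω (A x) (A y) = ω x y) ∧
      ∀ j, Submodule.map (A : E →ₗ[ℝ] E) (L j) = L' j := by
  let A := F.basis.equiv F'.basis (σ.sumCongr σ)
  have hAe : ∀ i, A (F.e i) = F'.e (σ i) := fun i => by
    rw [← F.basis_inl, Basis.equiv_apply]; simp
  have hAf : ∀ i, A (F.f i) = F'.f (σ i) := fun i => by
    rw [← F.basis_inr, Basis.equiv_apply]; simp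
  refine ⟨A, fun x y => ?_, fun j => ?_⟩
  · have h : ω.comp (A : E →ₗ[ℝ] E) (A : E →ₗ[ℝ] E) = ω := by
      refine LinearMap.BilinForm.ext_basis F.basis ?_
      rintro (i | i) (l | l) <;>
        simp [hAe, hAf, F.ee, F.ef, F.fe, F.ff, F'.ee, F'.ef, F'.fe, F'.ff]
    exact LinearMap.congr_fun₂ h x y
  · have h : (A : E →ₗ[ℝ] E) ∘ F.line j = F'.line j ∘ σ := by
      ext i
      simp [AdaptedFrame.line, hAe, hAf, hσ]
    rw [← F.span_line hL, Submodule.map_span, ← Set.range_comp, h, Set.range_comp,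
      σ.surjective.range_eq, Set.image_univ, F'.span_line hL']


open Classical in
lemma PlaneType.card_eq_of_invariants_eq {n n' : ℕ} (t : Fin n → PlaneType)
    (t' : Fin n' → PlaneType) (hn : n = n')
    (h012 : (∑ i, if (t i).pairing 1 0 = 0 ∧ (t i).pairing 2 0 = 0 then 1 else 0) =
      ∑ i, if (t' i).pairing 1 0 = 0 ∧ (t' i).pairing 2 0 = 0 then 1 else 0)
    (h01 : (∑ i, if (t i).pairing 1 0 = 0 then 1 else 0) =
      ∑ i, if (t' i).pairing 1 0 = 0 then 1 else 0)
    (h12 : (∑ i, if (t i).pairing 2 1 = 0 then 1 else 0) =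
      ∑ i, if (t' i).pairing 2 1 = 0 then 1 else 0)
    (h20 : (∑ i, if (t i).pairing 0 2 = 0 then 1 else 0) =
      ∑ i, if (t' i).pairing 0 2 = 0 then 1 else 0)
    (hsig : (∑ i, ∑ k, ((if 0 < (t i).weight k then (1 : ℤ) else 0) -
        if (t i).weight k < 0 then 1 else 0)) =
      ∑ i, ∑ k, ((if 0 < (t' i).weight k then (1 : ℤ) else 0) -
        if (t' i).weight k < 0 then 1 else 0)) (s : PlaneType) :
    Fintype.card {i // t i = s} = Fintype.card {i // t' i = s} := by
  have key : ∀ {M : Type} [CommSemiring M] (g : PlaneType → M),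
      ∑ i, g (t i) = ∑ i, g (t' i) →
      ∑ s, (Fintype.card {i // t i = s} : M) * g s =
        ∑ s, (Fintype.card {i // t' i = s} : M) * g s := fun g h => by
    rwa [← sum_comp_eq_sum_card_mul, ← sum_comp_eq_sum_card_mul]
  have hn' := key (M := ℕ) (fun _ => 1) (by simpa using hn)
  replace h012 := key (fun s => if s.pairing 1 0 = 0 ∧ s.pairing 2 0 = 0 then 1 else 0) h012
  replace h01 := key (fun s => if s.pairing 1 0 = 0 then 1 else 0) h01
  replace h12 := key (fun s => if s.pairing 2 1 = 0 then 1 else 0) h12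
  replace h20 := key (fun s => if s.pairing 0 2 = 0 then 1 else 0) h20
  replace hsig := key (fun s => ∑ k, ((if 0 < s.weight k then (1 : ℤ) else 0) -
        if s.weight k < 0 then 1 else 0)) hsig
  simp [sum_eq, pairing, fst, snd, weight, Fin.sum_univ_three] at hn' h012 h01 h12 h20 hsig
  cases s <;> omega

/-- the dimensions of the (pairwise and triple) intersections together with the
signature classify triplets of Lagrangian subspaces up to symplectic transformations. -/
theorem lagrangian_triplet_classification [FiniteDimensional ℝ E]
    (ω : BilinForm ℝ E) (halt : LinearMap.IsAlt ω)
    (hnd : LinearMap.BilinForm.Nondegenerate ω)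
    (L1 L2 L3 L1' L2' L3' : Submodule ℝ E)
    (h1 : IsLagrangian ω L1) (h2 : IsLagrangian ω L2) (h3 : IsLagrangian ω L3)
    (h1' : IsLagrangian ω L1') (h2' : IsLagrangian ω L2') (h3' : IsLagrangian ω L3')
    (htriple : Module.finrank ℝ ↥(L1 ⊓ L2 ⊓ L3) = Module.finrank ℝ ↥(L1' ⊓ L2' ⊓ L3'))
    (h12 : Module.finrank ℝ ↥(L1 ⊓ L2) = Module.finrank ℝ ↥(L1' ⊓ L2'))
    (h23 : Module.finrank ℝ ↥(L2 ⊓ L3) = Module.finrank ℝ ↥(L2' ⊓ L3'))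
    (h31 : Module.finrank ℝ ↥(L3 ⊓ L1) = Module.finrank ℝ ↥(L3' ⊓ L1'))
    (hsig : tripleSig ω L1 L2 L3 = tripleSig ω L1' L2' L3') :
    ∃ A : E ≃ₗ[ℝ] E, (∀ x y : E, ω (A x) (A y) = ω x y) ∧
      Submodule.map (A : E →ₗ[ℝ] E) L1 = L1' ∧
      Submodule.map (A : E →ₗ[ℝ] E) L2 = L2' ∧
      Submodule.map (A : E →ₗ[ℝ] E) L3 = L3' := by
  have hL : ∀ j, IsLagrangian ω (![L1, L2, L3] j) := by
    intro j; fin_cases j <;> assumption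
  have hL' : ∀ j, IsLagrangian ω (![L1', L2', L3'] j) := by
    intro j; fin_cases j <;> assumption
  obtain ⟨n, ⟨F⟩⟩ := AdaptedFrame.exists_nonempty halt hnd hL
  obtain ⟨n', ⟨F'⟩⟩ := AdaptedFrame.exists_nonempty halt hnd hL'
  obtain ⟨σ, hσ⟩ : ∃ σ : Fin n ≃ Fin n', ∀ i, F'.type (σ i) = F.type i := by
    have hcard : ∀ s, Fintype.card {i // F.type i = s} = Fintype.card {i // F'.type i = s} :=
      PlaneType.card_eq_of_invariants_eq F.type F'.type
        (by have h := F.finrank_eq.symm.trans F'.finrank_eq; omega)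
        ((F.finrank_inf_inf hL 0 1 2).symm.trans (htriple.trans (F'.finrank_inf_inf hL' 0 1 2)))
        ((F.finrank_inf hL 0 1).symm.trans (h12.trans (F'.finrank_inf hL' 0 1)))
        ((F.finrank_inf hL 1 2).symm.trans (h23.trans (F'.finrank_inf hL' 1 2)))
        ((F.finrank_inf hL 2 0).symm.trans (h31.trans (F'.finrank_inf hL' 2 0)))
        ((F.tripleSig_eq_sum hL).symm.trans (hsig.trans (F'.tripleSig_eq_sum hL')))
    exact ⟨Equiv.ofFiberEquiv fun s => Fintype.equivOfCardEq (hcard s),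
      Equiv.ofFiberEquiv_map _⟩
  obtain ⟨A, hA, hmap⟩ := F.exists_equiv F' hL hL' σ hσ
  exact ⟨A, hA, hmap 0, hmap 1, hmap 2⟩
end
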